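/- arXiv:2408.13037 — 2 statements merged into one kernel-verified Lean document; each statement's English description precedes it below -/
import Mathlib

section
/- Let G be a finite abelian p-group, B_n a Haar-uniform n×n band matrix over Z_p with band width w_n. Then E|Sur(cok(B_n), G)| = ∑_{g} ∏_{k=1}^n |H_g(k)|^{-1}, where the sum is over all g : [1,n] → G whose components generate G, and H_g(k) = ⟨g(j) : max(1,k-w_n) ≤ j ≤ min(n,k+w_n)⟩. -/
open MeasureTheory
open scoped ENNReal Classical

section PadicModule

variable {p : ℕ} [Fact p.Prime] {G : Type*} [AddCommGroup G] [Module ℤ_[p] G]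

/-- On a `p`-power torsion element, a `p`-adic integer acts through any natural number that
approximates it well enough. -/
theorem exists_nat_smul_eq_padicInt_smul {g : G} (hg : ∃ k : ℕ, (p ^ k : ℕ) • g = 0)
    (x : ℤ_[p]) : ∃ m : ℕ, x • g = m • g := by
  obtain ⟨k, hk⟩ := hg
  refine ⟨x.appr k, ?_⟩
  obtain ⟨z, hz⟩ := Ideal.mem_span_singleton'.1 (PadicInt.appr_spec k x)
  have hk' : ((p : ℤ_[p]) ^ k) • g = 0 := by
    rw [← hk, ← Nat.cast_smul_eq_nsmul ℤ_[p], Nat.cast_pow]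
  rw [← sub_eq_zero, ← Nat.cast_smul_eq_nsmul ℤ_[p], ← sub_smul, ← hz, mul_smul, hk', smul_zero]

/-- In a `p`-power torsion `ℤ_[p]`-module, the span of a set is the subgroup it generates. -/
theorem padicInt_span_toAddSubgroup (hG : ∀ g : G, ∃ k : ℕ, (p ^ k : ℕ) • g = 0) (s : Set G) :
    (Submodule.span ℤ_[p] s).toAddSubgroup = AddSubgroup.closure s := by
  refine le_antisymm (fun x hx => ?_) ((AddSubgroup.closure_le _).2 Submodule.subset_span)
  refine Submodule.span_induction (fun x hx => AddSubgroup.subset_closure hx) (zero_mem _)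
    (fun x y _ _ hx hy => add_mem hx hy) (fun a x _ hx => ?_) hx
  obtain ⟨m, hm⟩ := exists_nat_smul_eq_padicInt_smul (hG x) a
  rw [hm]
  exact nsmul_mem hx m

theorem mem_closure_iff_mem_padicInt_span (hG : ∀ g : G, ∃ k : ℕ, (p ^ k : ℕ) • g = 0)
    {s : Set G} {x : G} : x ∈ AddSubgroup.closure s ↔ x ∈ Submodule.span ℤ_[p] s := by
  rw [← padicInt_span_toAddSubgroup hG, Submodule.mem_toAddSubgroup]

theorem closure_eq_top_iff_padicInt_span (hG : ∀ g : G, ∃ k : ℕ, (p ^ k : ℕ) • g = 0)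
    {s : Set G} : AddSubgroup.closure s = ⊤ ↔ Submodule.span ℤ_[p] s = ⊤ := by
  simp [AddSubgroup.eq_top_iff', Submodule.eq_top_iff', mem_closure_iff_mem_padicInt_span hG]

/-- The orbit map of a `p`-power torsion element is locally constant. -/
theorem continuous_padicInt_smul_const [TopologicalSpace G] [DiscreteTopology G] {g : G}
    (hg : ∃ k : ℕ, (p ^ k : ℕ) • g = 0) : Continuous fun x : ℤ_[p] => x • g := by
  obtain ⟨k, hk⟩ := hg
  have hk' : ((p : ℤ_[p]) ^ k) • g = 0 := by
    rw [← hk, ← Nat.cast_smul_eq_nsmul ℤ_[p], Nat.cast_pow]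
  refine continuous_iff_continuousAt.2 fun x => ?_
  rw [ContinuousAt, nhds_discrete G, Filter.tendsto_pure]
  have hp : (0 : ℝ) < (p : ℝ) ^ (-(k : ℤ)) :=
    zpow_pos (Nat.cast_pos.2 (Fact.out : p.Prime).pos) _
  filter_upwards [Metric.closedBall_mem_nhds x hp] with y hy
  rw [Metric.mem_closedBall, dist_eq_norm, PadicInt.norm_le_pow_iff_mem_span_pow] at hy
  obtain ⟨z, hz⟩ := Ideal.mem_span_singleton'.1 hy
  rw [← sub_eq_zero, ← sub_smul, ← hz, mul_smul, hk', smul_zero]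

end PadicModule

/-- Multiplication of a matrix with scalar entries by a vector with entries in a module. -/
def matrixSMulVec {R M m n : Type*} [Semiring R] [AddCommMonoid M] [Module R M] [Fintype n]
    (g : n → M) : Matrix m n R →+ (m → M) where
  toFun B i := ∑ j, B i j • g j
  map_zero' := by ext; simp
  map_add' B C := by ext; simp [add_smul, Finset.sum_add_distrib]

theorem matrixSMulVec_apply {R M m n : Type*} [Semiring R] [AddCommMonoid M] [Module R M]
    [Fintype n] (g : n → M) (B : Matrix m n R) (i : m) :
    matrixSMulVec g B i = ∑ j, B i j • g j := rfl

theorem continuous_matrixSMulVec {p : ℕ} [Fact p.Prime] {G m n : Type*} [AddCommGroup G]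
    [Module ℤ_[p] G] [Fintype n] [TopologicalSpace G] [DiscreteTopology G]
    (hG : ∀ g : G, ∃ k : ℕ, (p ^ k : ℕ) • g = 0) (g : n → G) :
    Continuous (matrixSMulVec g : Matrix m n ℤ_[p] →+ (m → G)) := by
  refine continuous_pi fun i => ?_
  simp only [matrixSMulVec_apply]
  exact continuous_finsetSum _ fun j _ =>
    (continuous_padicInt_smul_const (hG (g j))).comp (continuous_id.matrix_elem i j)

theorem measurableSet_matrixSMulVec_eq {p : ℕ} [Fact p.Prime] {G m n : Type*} [AddCommGroup G]
    [Module ℤ_[p] G] [Finite m] [Fintype n] [MeasurableSpace (Matrix m n ℤ_[p])]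
    [BorelSpace (Matrix m n ℤ_[p])] (hG : ∀ g : G, ∃ k : ℕ, (p ^ k : ℕ) • g = 0)
    (g : n → G) (v : m → G) :
    MeasurableSet {B : Matrix m n ℤ_[p] | matrixSMulVec g B = v} := by
  let _ : TopologicalSpace G := ⊥
  have : DiscreteTopology G := ⟨rfl⟩
  exact ((isOpen_discrete {v}).preimage (continuous_matrixSMulVec hG g)).measurableSet

/-- Homomorphisms out of the cokernel of `B` are the vectors annihilated by `B`, and surjections
correspond to generating vectors. -/
def surjectiveCokernelHomEquiv {R M m n : Type*} [CommRing R] [AddCommGroup M] [Module R M]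
    [Fintype n] [DecidableEq n] (B : Matrix m n R) :
    {f : ((n → R) ⧸ Submodule.span R (Set.range B)) →ₗ[R] M // Function.Surjective f} ≃
      {g : n → M // Submodule.span R (Set.range g) = ⊤ ∧ matrixSMulVec g B = 0} where
  toFun f := ⟨fun j => f.1 (Submodule.mkQ _ (Pi.single j 1)), by
    have key : Fintype.linearCombination R
        (fun j => f.1 (Submodule.mkQ (Submodule.span R (Set.range B)) (Pi.single j 1))) =
          f.1.comp (Submodule.mkQ _) := by
      ext j
      simp
    refine ⟨?_, ?_⟩
    · rw [← Fintype.range_linearCombination, key, LinearMap.range_eq_top]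
      exact f.2.comp (Submodule.mkQ_surjective _)
    · ext i
      rw [matrixSMulVec_apply, ← Fintype.linearCombination_apply, key, LinearMap.comp_apply]
      have hrow : Submodule.mkQ (Submodule.span R (Set.range B)) (B i) = 0 :=
        (Submodule.Quotient.mk_eq_zero _).2 (Submodule.subset_span (Set.mem_range_self i))
      exact (congrArg f.1 hrow).trans (map_zero f.1)⟩
  invFun g := ⟨Submodule.liftQ _ (Fintype.linearCombination R g.1) (by
      rw [Submodule.span_le]
      rintro _ ⟨i, rfl⟩
      exact congrFun g.2.2 i), by
    rw [← LinearMap.range_eq_top, Submodule.range_liftQ, Fintype.range_linearCombination, g.2.1]⟩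
  left_inv f := by
    ext j
    simp
  right_inv g := by
    ext j
    simp

/-- If a measure carried by the matrices supported on `S` is invariant under translations by such
matrices, then `B ↦ B g` is equidistributed on the vectors whose `i`-th entry lies in the group
generated by the `g j` with `(i, j) ∈ S`. -/
theorem measure_matrixSMulVec_eq_zero {p : ℕ} [Fact p.Prime] {G m n : Type*} [AddCommGroup G]
    [Module ℤ_[p] G] [Finite G] [Fintype m] [Fintype n] [MeasurableSpace (Matrix m n ℤ_[p])]
    [BorelSpace (Matrix m n ℤ_[p])] (hG : ∀ g : G, ∃ k : ℕ, (p ^ k : ℕ) • g = 0)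
    (μ : Measure (Matrix m n ℤ_[p])) [IsProbabilityMeasure μ] (S : m → Set n)
    (hsupp : ∀ᵐ B ∂μ, ∀ i j, j ∉ S i → B i j = 0)
    (hinv : ∀ C : Matrix m n ℤ_[p], (∀ i j, j ∉ S i → C i j = 0) →
      μ.map (fun B => B + C) = μ) (g : n → G) :
    μ {B | matrixSMulVec g B = 0} =
      ∏ i, (Nat.card (AddSubgroup.closure (g '' S i)) : ℝ≥0∞)⁻¹ := by
  let H : m → AddSubgroup G := fun i => AddSubgroup.closure (g '' S i)
  have : Fintype (∀ i, H i) := Fintype.ofFinite _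
  have htranslate (v : ∀ i, H i) : μ {B | matrixSMulVec g B = fun i => (v i : G)} =
      μ {B | matrixSMulVec g B = 0} := by
    have hrow (i : m) : ∃ c : n → ℤ_[p], (∀ j, j ∉ S i → c j = 0) ∧
        ∑ j, c j • g j = (v i : G) := by
      have hv := (mem_closure_iff_mem_padicInt_span hG).1 (v i).2
      obtain ⟨c, hc, hcv⟩ := (Finsupp.mem_span_image_iff_linearCombination ℤ_[p]).1 hv
      refine ⟨c, fun j hj => ?_, ?_⟩
      · exact (Finsupp.mem_supported' _ _).1 hc j hj
      · rw [← hcv, Finsupp.linearCombination_apply, Finsupp.sum_fintype _ _ (by simp)]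
    choose C hC hCv using hrow
    have hCv' : matrixSMulVec g (Matrix.of C) = fun i => (v i : G) := funext hCv
    conv_lhs => rw [← hinv (Matrix.of C) hC]
    rw [Measure.map_apply (continuous_add_const (Matrix.of C)).measurable
      (measurableSet_matrixSMulVec_eq hG g _)]
    congr 1
    ext B
    simp only [Set.mem_preimage, Set.mem_ofPred_eq, map_add, ← hCv', add_eq_right]
  have hcover : ∀ᵐ B ∂μ, B ∈ ⋃ v : ∀ i, H i, {B | matrixSMulVec g B = fun i => (v i : G)} := by
    filter_upwards [hsupp] with B hB
    refine Set.mem_iUnion.2 ⟨fun i => ⟨matrixSMulVec g B i, sum_mem fun j _ => ?_⟩, rfl⟩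
    by_cases hj : j ∈ S i
    · exact (mem_closure_iff_mem_padicInt_span hG).2
        (Submodule.smul_mem _ _ (Submodule.subset_span ⟨j, hj, rfl⟩))
    · rw [hB i j hj, zero_smul]
      exact zero_mem _
  have hsum : ∑ v : ∀ i, H i, μ {B | matrixSMulVec g B = fun i => (v i : G)} = 1 := by
    rw [← tsum_fintype (L := .unconditional _), ← measure_iUnion _ fun v => measurableSet_matrixSMulVec_eq hG g _,
      ← prob_compl_eq_zero_iff (MeasurableSet.iUnion fun v =>
        measurableSet_matrixSMulVec_eq hG g _)]
    · exact hcover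
    · refine fun v w hvw => Set.disjoint_left.2 fun B hv hw => hvw ?_
      ext i
      exact congrFun (hv.symm.trans hw) i
  simp only [htranslate, Finset.sum_const, Finset.card_univ, nsmul_eq_mul] at hsum
  rw [← Nat.card_eq_fintype_card, Nat.card_pi, Nat.cast_prod, mul_comm] at hsum
  rw [ENNReal.eq_inv_of_mul_eq_one_left hsum, ENNReal.prod_inv_distrib]
  exact fun i _ j _ _ => Or.inr (ENNReal.natCast_ne_top _)

/-- For a Haar-uniform `n × n` band matrix `B_n` over `ℤ_[p]` with band width
`w_n` (Haar-uniformity formalized via translation invariance and support, as in Statement 2),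
`E|Sur(cok(B_n), G)| = ∑_{g : [1,n] → G, ⟨g⟩ = G} ∏_{k=1}^n |H_g(k)|⁻¹`, where
`H_g(k) = ⟨g j : max(1, k - w_n) ≤ j ≤ min(n, k + w_n)⟩`. -/
theorem stmt3 (p : ℕ) [Fact p.Prime] (n wn : ℕ) (hn : 0 < n) (hw : 0 < wn)
    (G : Type*) [AddCommGroup G] [Module ℤ_[p] G] [Fintype G]
    (hG : ∀ g : G, ∃ k : ℕ, (p ^ k : ℕ) • g = 0)
    [MeasurableSpace (Matrix (Fin n) (Fin n) ℤ_[p])]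
    [BorelSpace (Matrix (Fin n) (Fin n) ℤ_[p])]
    (μ : Measure (Matrix (Fin n) (Fin n) ℤ_[p])) [IsProbabilityMeasure μ]
    (hsupp : μ {B | ¬ ∀ i j : Fin n, (wn : ℤ) < |(i : ℤ) - (j : ℤ)| → B i j = 0} = 0)
    (hinv : ∀ C : Matrix (Fin n) (Fin n) ℤ_[p],
      (∀ i j : Fin n, (wn : ℤ) < |(i : ℤ) - (j : ℤ)| → C i j = 0) →
      μ.map (fun B => B + C) = μ) :
    ∫⁻ B, (Nat.card {f : ((Fin n → ℤ_[p]) ⧸ Submodule.span ℤ_[p] (Set.range B)) →ₗ[ℤ_[p]] G //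
            Function.Surjective f} : ℝ≥0∞) ∂μ
      = ∑ g : Fin n → G,
          if AddSubgroup.closure (Set.range g) = ⊤ then
            ∏ k : Fin n,
              (Nat.card (AddSubgroup.closure
                (g '' {j : Fin n | |(j : ℤ) - (k : ℤ)| ≤ (wn : ℤ)})) : ℝ≥0∞)⁻¹
          else 0 := by
  have hcount (B : Matrix (Fin n) (Fin n) ℤ_[p]) :
      (Nat.card {f : ((Fin n → ℤ_[p]) ⧸ Submodule.span ℤ_[p] (Set.range B)) →ₗ[ℤ_[p]] G //
        Function.Surjective f} : ℝ≥0∞) =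
      ∑ g : Fin n → G, if AddSubgroup.closure (Set.range g) = ⊤ then
        Set.indicator {B | matrixSMulVec g B = 0} 1 B else 0 := by
    rw [Nat.card_congr (surjectiveCokernelHomEquiv B), Nat.card_eq_fintype_card,
      Fintype.card_subtype, Finset.card_filter, Nat.cast_sum]
    refine Finset.sum_congr rfl fun g _ => ?_
    simp only [closure_eq_top_iff_padicInt_span hG, Set.indicator_apply, Set.mem_ofPred_eq,
      Pi.one_apply, ite_and, Nat.cast_ite, Nat.cast_one, Nat.cast_zero]
  have hmeas (g : Fin n → G) :
      MeasurableSet {B : Matrix (Fin n) (Fin n) ℤ_[p] | matrixSMulVec g B = 0} :=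
    measurableSet_matrixSMulVec_eq hG g 0
  have hband (i j : Fin n) : j ∉ {j : Fin n | |(j : ℤ) - (i : ℤ)| ≤ (wn : ℤ)} ↔
      (wn : ℤ) < |(i : ℤ) - (j : ℤ)| := by
    rw [Set.mem_ofPred_eq, not_le, abs_sub_comm]
  simp only [hcount]
  rw [lintegral_finsetSum]
  · refine Finset.sum_congr rfl fun g _ => ?_
    split_ifs
    · rw [lintegral_indicator_one (hmeas g)]
      refine measure_matrixSMulVec_eq_zero hG μ
        (fun k => {j : Fin n | |(j : ℤ) - (k : ℤ)| ≤ (wn : ℤ)}) ?_ ?_ g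
      · simpa only [hband] using ae_iff.2 hsupp
      · simpa only [hband] using hinv
    · exact lintegral_zero
  · intro g _
    split_ifs
    · exact measurable_one.indicator (hmeas g)
    · exact measurable_const
end

section
/- Let B be a Haar-uniform n×n band matrix over F_p with band width w, and suppose 2n p^{-w} ≤ q for a constant q. Then E|ker B| ≤ 1 + (q+4)^2 exp(q^2), where |ker B| denotes the cardinality of the kernel of B as a subspace of F_p^n. Consequently, by Markov's inequality, P(dim ker B ≥ k) ≤ (1 + (q+4)^2 exp(q^2)) p^{-k} for every nonnegative integer k. -/
open scoped Classical

open Finset in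
/-- The number of positions `i < d + m` which are either among the first `v` ones or within
distance `w` of the support of `x`, where `x` is placed at the positions `d, …, d + m - 1`. -/
noncomputable def coveredCard {F : Type*} [Zero F] (w v m d : ℕ) (x : Fin m → F) : ℕ :=
  #{i ∈ range (d + m) | i + 1 ≤ v ∨ ∃ j : Fin m, x j ≠ 0 ∧ i ≤ d + j + w ∧ d + j ≤ i + w}

open Finset in
theorem coveredCard_zero {F : Type*} [Zero F] (w v d : ℕ) (x : Fin 0 → F) :
    min d v ≤ coveredCard w v 0 d x := by
  have h : range (min d v) ⊆ {i ∈ range (d + 0) | i + 1 ≤ v ∨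
      ∃ j : Fin 0, x j ≠ 0 ∧ i ≤ d + j + w ∧ d + j ≤ i + w} := by
    intro i hi
    simp only [mem_range, mem_filter] at *
    exact ⟨by omega, Or.inl (by omega)⟩
  simpa [coveredCard] using card_le_card h

open Finset in
theorem coveredCard_cons_zero {F : Type*} [Zero F] (w v m d : ℕ) (x : Fin m → F) :
    coveredCard w v (m + 1) d (Fin.cons 0 x : Fin (m + 1) → F) = coveredCard w v m (d + 1) x := by
  unfold coveredCard
  congr 1
  ext i
  simp only [mem_filter, mem_range, Fin.exists_fin_succ, Fin.cons_zero, Fin.cons_succ, ne_eq,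
    not_true_eq_false, false_and, false_or, Fin.val_succ]
  simp only [add_comm, add_left_comm]

open Finset in
theorem coveredCard_cons_of_ne {F : Type*} [Zero F] (w v m d : ℕ) (x : Fin m → F) {a : F}
    (ha : a ≠ 0) : min (d + 1) (v + w + 1) + coveredCard w w m 0 x ≤
      coveredCard w v (m + 1) d (Fin.cons a x : Fin (m + 1) → F) := by
  unfold coveredCard
  set P : ℕ → Prop := fun i => i + 1 ≤ v ∨ ∃ j : Fin (m + 1),
    (Fin.cons a x : Fin (m + 1) → F) j ≠ 0 ∧ i ≤ d + j + w ∧ d + j ≤ i + w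
  set Q : ℕ → Prop := fun i => i + 1 ≤ w ∨ ∃ j : Fin m, x j ≠ 0 ∧ i ≤ 0 + j + w ∧ 0 + j ≤ i + w
  have hhead : ∀ i, i ≤ d + w → d ≤ i + w → P i := fun i h₁ h₂ =>
    Or.inr ⟨0, by simpa using ha, by simpa using h₁, by simpa using h₂⟩
  have hsplit : range (d + (m + 1)) = range (d + 1 + m) := by congr 1; omega
  have htail : #{i ∈ range (0 + m) | Q i} ≤ #{i ∈ Ico (d + 1) (d + 1 + m) | P i} := by
    refine card_le_card_of_injOn (fun i => d + 1 + i) ?_ (fun i _ j _ h => by simpa using h)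
    intro i hi
    simp only [coe_filter, mem_range, mem_Ico, Set.mem_ofPred_eq] at *
    refine ⟨⟨by omega, by omega⟩, ?_⟩
    rcases hi.2 with h | ⟨j, hj, h₁, h₂⟩
    · exact hhead _ (by omega) (by omega)
    · exact Or.inr ⟨j.succ, by simpa using hj, by simp only [Fin.val_succ]; omega,
        by simp only [Fin.val_succ]; omega⟩
  have hinit : min (d + 1) (v + w + 1) ≤ #{i ∈ range (d + 1) | P i} := by
    have hsub : range (min v (d - w)) ∪ Ico (d - w) (d + 1) ⊆ {i ∈ range (d + 1) | P i} := by
      intro i hi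
      simp only [mem_union, mem_range, mem_Ico, mem_filter] at *
      rcases hi with h | h
      · exact ⟨by omega, Or.inl (by omega)⟩
      · exact ⟨by omega, hhead i (by omega) (by omega)⟩
    have hdisj : Disjoint (range (min v (d - w))) (Ico (d - w) (d + 1)) := by
      rw [disjoint_left]
      intro i h₁ h₂
      simp only [mem_range, mem_Ico] at *
      omega
    have := card_le_card hsub
    rw [card_union_of_disjoint hdisj, card_range, Nat.card_Ico] at this
    omega
  rw [hsplit]
  have hunion : {i ∈ range (d + 1) | P i} ∪ {i ∈ Ico (d + 1) (d + 1 + m) | P i} ⊆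
      {i ∈ range (d + 1 + m) | P i} := by
    intro i hi
    simp only [mem_union, mem_filter, mem_range, mem_Ico] at *
    rcases hi with h | h
    · exact ⟨by omega, h.2⟩
    · exact ⟨by omega, h.2⟩
  have hdisj : Disjoint {i ∈ range (d + 1) | P i} {i ∈ Ico (d + 1) (d + 1 + m) | P i} := by
    rw [disjoint_left]
    intro i h₁ h₂
    simp only [mem_filter, mem_range, mem_Ico] at *
    omega
  have := card_le_card hunion
  rw [card_union_of_disjoint hdisj] at this
  exact (add_le_add hinit htail).trans this

/-- The sum of `p ^ (-coveredCard w v m d x)` over all vectors `x` of length `m`. -/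
noncomputable def coveredSum (p : ℕ) [Fact p.Prime] (w v m d : ℕ) : ℝ :=
  ∑ x : Fin m → ZMod p, (p : ℝ)⁻¹ ^ coveredCard w v m d x

section coveredSum

variable (p : ℕ) [Fact p.Prime]

theorem inv_prime_pos : 0 < (p : ℝ)⁻¹ := inv_pos.2 (mod_cast (Fact.out : p.Prime).pos)

theorem inv_prime_le_one : (p : ℝ)⁻¹ ≤ 1 :=
  inv_le_one_of_one_le₀ (mod_cast (Fact.out : p.Prime).one_le)

theorem coveredSum_nonneg (w v m d : ℕ) : 0 ≤ coveredSum p w v m d :=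
  Finset.sum_nonneg fun _ _ => pow_nonneg (inv_prime_pos p).le _

theorem coveredSum_zero_le (w v d : ℕ) : coveredSum p w v 0 d ≤ (p : ℝ)⁻¹ ^ min d v := by
  simp only [coveredSum, Finset.univ_unique, Finset.sum_singleton]
  exact pow_le_pow_of_le_one (inv_prime_pos p).le (inv_prime_le_one p) (coveredCard_zero ..)

theorem coveredSum_succ_le (w v m d : ℕ) :
    coveredSum p w v (m + 1) d ≤ coveredSum p w v m (d + 1) +
      ((p : ℝ) - 1) * ((p : ℝ)⁻¹ ^ min (d + 1) (v + w + 1) * coveredSum p w w m 0) := by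
  have hp := (Fact.out : p.Prime)
  rw [coveredSum, ← (Fin.consEquiv fun _ : Fin (m + 1) => ZMod p).sum_comp,
    Fintype.sum_prod_type, Fintype.sum_eq_add_sum_compl 0]
  refine add_le_add (le_of_eq ?_) ?_
  · exact Finset.sum_congr rfl fun x _ => congrArg _ (coveredCard_cons_zero w v m d x)
  · have hcard : (((({0} : Finset (ZMod p))ᶜ).card : ℕ) : ℝ) = (p : ℝ) - 1 := by
      rw [Finset.card_compl, ZMod.card, Finset.card_singleton, Nat.cast_sub hp.one_le, Nat.cast_one]
    rw [← hcard, ← nsmul_eq_mul]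
    refine Finset.sum_le_card_nsmul _ _ _ fun a ha => ?_
    rw [coveredSum, Finset.mul_sum]
    refine Finset.sum_le_sum fun x _ => ?_
    rw [← pow_add]
    exact pow_le_pow_of_le_one (inv_prime_pos p).le (inv_prime_le_one p)
      (coveredCard_cons_of_ne w v m d x (by simpa using ha))

theorem pow_min_le_add {r : ℝ} (hr : 0 ≤ r) (a b : ℕ) : r ^ min a b ≤ r ^ a + r ^ b := by
  rcases min_choice a b with h | h <;> rw [h]
  · linarith [pow_nonneg hr b]
  · linarith [pow_nonneg hr a]

theorem sub_one_mul_pow_min_le (v d : ℕ) :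
    ((p : ℝ) - 1) * (p : ℝ)⁻¹ ^ min (d + 1) (v + 1) ≤
      (1 - (p : ℝ)⁻¹) * (p : ℝ)⁻¹ ^ d + (p : ℝ)⁻¹ ^ v := by
  have hp : (1 : ℝ) ≤ p := mod_cast (Fact.out : p.Prime).one_le
  have h := mul_le_mul_of_nonneg_left (pow_min_le_add (inv_prime_pos p).le (d + 1) (v + 1))
    (sub_nonneg.2 hp)
  have hpr : (p : ℝ) * (p : ℝ)⁻¹ = 1 := mul_inv_cancel₀ (by positivity)
  have hv : 0 ≤ (p : ℝ)⁻¹ * (p : ℝ)⁻¹ ^ v := by positivity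
  have e : ((p : ℝ) - 1) * ((p : ℝ)⁻¹ ^ (d + 1) + (p : ℝ)⁻¹ ^ (v + 1)) =
      (1 - (p : ℝ)⁻¹) * (p : ℝ)⁻¹ ^ d + (p : ℝ)⁻¹ ^ v - (p : ℝ)⁻¹ * (p : ℝ)⁻¹ ^ v := by
    rw [pow_succ, pow_succ]
    linear_combination ((p : ℝ)⁻¹ ^ d + (p : ℝ)⁻¹ ^ v) * hpr
  linarith

theorem coveredSum_self_le (w m d : ℕ) :
    coveredSum p w w m d ≤
      (1 + 2 * (p : ℝ)⁻¹ ^ w) ^ m * ((p : ℝ)⁻¹ ^ d + 2 * (p : ℝ)⁻¹ ^ w) := by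
  have hr := inv_prime_pos p
  have hr1 := inv_prime_le_one p
  induction m generalizing d with
  | zero =>
    refine (coveredSum_zero_le p w w d).trans ((pow_min_le_add hr.le d w).trans ?_)
    rw [pow_zero, one_mul]
    linarith [pow_pos hr w]
  | succ m ih =>
    refine (coveredSum_succ_le p w w m d).trans ?_
    have h₁ := ih (d + 1)
    have h₂ := ih 0
    have h₃ := sub_one_mul_pow_min_le p (w + w) d
    have hS := coveredSum_nonneg p w w m 0
    rw [← mul_assoc]
    set r := (p : ℝ)⁻¹
    have hc : 0 < r ^ w := pow_pos hr w
    have hc1 : r ^ w ≤ 1 := pow_le_one₀ hr.le hr1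
    have hd : 0 < r ^ d := pow_pos hr d
    rw [pow_add r w w] at h₃
    rw [pow_succ r d] at h₁
    rw [pow_zero] at h₂
    have hL : 0 < (1 + 2 * r ^ w) ^ m := by positivity
    rw [pow_succ (1 + 2 * r ^ w) m]
    set c := r ^ w
    set D := r ^ d
    set L := (1 + 2 * c) ^ m
    have hcoef : 0 ≤ (1 - r) * D + c * c := by nlinarith
    have h₄ := mul_le_mul h₃ h₂ hS hcoef
    have key : D * r + 2 * c + ((1 - r) * D + c * c) * (1 + 2 * c) ≤
        (1 + 2 * c) * (D + 2 * c) := by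
      have : 0 ≤ c * c * (1 - c) := mul_nonneg (by positivity) (by linarith)
      have : 0 ≤ c * (r * D) := by positivity
      nlinarith
    have := mul_le_mul_of_nonneg_left key hL.le
    linarith

theorem coveredSum_zero_bound {w m n : ℕ} (d : ℕ) (hmn : m ≤ n) :
    coveredSum p w 0 m d ≤
      1 + (1 + 2 * (p : ℝ)⁻¹ ^ w) ^ n * ((p : ℝ)⁻¹ ^ d + m * (p : ℝ)⁻¹ ^ w) := by
  have hr := inv_prime_pos p
  have hr1 := inv_prime_le_one p
  induction m generalizing d with
  | zero =>
    refine (coveredSum_zero_le p w 0 d).trans ?_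
    rw [Nat.min_zero, pow_zero, le_add_iff_nonneg_right]
    positivity
  | succ m ih =>
    refine (coveredSum_succ_le p w 0 m d).trans ?_
    have h₁ := ih (d + 1) (by omega)
    have h₃ := sub_one_mul_pow_min_le p w d
    have hS := coveredSum_nonneg p w w m 0
    have h₂ : coveredSum p w w m 0 ≤ (1 + 2 * (p : ℝ)⁻¹ ^ w) ^ n := by
      refine (coveredSum_self_le p w m 0).trans ?_
      rw [pow_zero, ← pow_succ]
      exact pow_le_pow_right₀ (le_add_of_nonneg_right (by positivity)) hmn
    rw [← mul_assoc, Nat.zero_add]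
    push_cast
    set r := (p : ℝ)⁻¹
    have hc : 0 < r ^ w := pow_pos hr w
    have hd : 0 < r ^ d := pow_pos hr d
    rw [pow_succ r d] at h₁
    have h₄ := mul_le_mul h₃ h₂ hS (by nlinarith)
    linarith

end coveredSum

open Finset in
theorem card_dotProduct_eq_zero_le {p : ℕ} [Fact p.Prime] {n : ℕ} (W : Fin n → Prop)
    (x : Fin n → ZMod p) :
    (#{r : Fin n → ZMod p | (∀ j, W j → r j = 0) ∧ r ⬝ᵥ x = 0} : ℝ) ≤
      (#{r : Fin n → ZMod p | ∀ j, W j → r j = 0} : ℝ) *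
        (if ∃ j, x j ≠ 0 ∧ ¬ W j then (p : ℝ)⁻¹ else 1) := by
  split_ifs with h
  · obtain ⟨j, hj, hW⟩ := h
    have hp : (0 : ℝ) < p := mod_cast (Fact.out : p.Prime).pos
    rw [← div_eq_mul_inv, le_div_iff₀ hp]
    have key : #((({r | (∀ j, W j → r j = 0) ∧ r ⬝ᵥ x = 0} : Finset (Fin n → ZMod p))) ×ˢ
        (univ : Finset (ZMod p))) ≤ #{r : Fin n → ZMod p | ∀ j, W j → r j = 0} := by
      refine card_le_card_of_injOn (fun s => s.1 + Pi.single j s.2) ?_ ?_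
      · rintro ⟨r, t⟩ hr
        simp only [coe_product, coe_filter, Set.mem_prod, Set.mem_ofPred_eq, mem_univ,
          true_and] at hr ⊢
        intro k hk
        have hkj : k ≠ j := fun e => hW (e ▸ hk)
        simp [hr.1.1 k hk, hkj]
      · rintro ⟨r, t⟩ hr ⟨r', t'⟩ hr' heq
        simp only [coe_product, coe_filter, Set.mem_prod, Set.mem_ofPred_eq, mem_univ,
          true_and] at hr hr' heq
        have hdot := congrArg (· ⬝ᵥ x) heq
        simp only [add_dotProduct, hr.1.2, hr'.1.2, single_dotProduct, zero_add] at hdot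
        have ht : t = t' := mul_right_cancel₀ hj hdot
        subst ht
        exact Prod.ext (add_right_cancel heq) rfl
    rw [card_product, card_univ, ZMod.card] at key
    exact_mod_cast key
  · rw [mul_one]
    exact_mod_cast card_le_card fun r hr => by
      simp only [mem_filter] at hr ⊢
      exact ⟨hr.1, hr.2.1⟩

open Finset in
theorem card_band_mulVec_eq_zero_le {p : ℕ} [Fact p.Prime] {n : ℕ} (w : ℕ) (x : Fin n → ZMod p) :
    (#{B : Matrix (Fin n) (Fin n) (ZMod p) |
        (∀ i j : Fin n, (w : ℤ) < |(i : ℤ) - (j : ℤ)| → B i j = 0) ∧ B.mulVec x = 0} : ℝ) ≤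
      (#{B : Matrix (Fin n) (Fin n) (ZMod p) |
        ∀ i j : Fin n, (w : ℤ) < |(i : ℤ) - (j : ℤ)| → B i j = 0} : ℝ) *
        (p : ℝ)⁻¹ ^ coveredCard w 0 n 0 x := by
  set W : Fin n → Fin n → Prop := fun i j => (w : ℤ) < |(i : ℤ) - (j : ℤ)|
  have e₁ : #{B : Matrix (Fin n) (Fin n) (ZMod p) | (∀ i j, W i j → B i j = 0) ∧ B.mulVec x = 0} =
      ∏ i, #{r : Fin n → ZMod p | (∀ j, W i j → r j = 0) ∧ r ⬝ᵥ x = 0} := by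
    rw [← Fintype.card_piFinset]
    congr 1
    ext B
    refine Iff.trans ?_ Fintype.mem_piFinset.symm
    simp only [mem_filter, mem_univ, true_and, funext_iff, forall_and]
    rfl
  have e₂ : #{B : Matrix (Fin n) (Fin n) (ZMod p) | ∀ i j, W i j → B i j = 0} =
      ∏ i, #{r : Fin n → ZMod p | ∀ j, W i j → r j = 0} := by
    rw [← Fintype.card_piFinset]
    congr 1
    ext B
    refine Iff.trans ?_ Fintype.mem_piFinset.symm
    simp only [mem_filter, mem_univ, true_and]
  have e₃ : (p : ℝ)⁻¹ ^ coveredCard w 0 n 0 x =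
      ∏ i : Fin n, if ∃ j, x j ≠ 0 ∧ ¬ W i j then (p : ℝ)⁻¹ else 1 := by
    have hcov : ∀ i : Fin n, (∃ j, x j ≠ 0 ∧ ¬ W i j) ↔
        ((i : ℕ) + 1 ≤ 0 ∨ ∃ j : Fin n, x j ≠ 0 ∧ (i : ℕ) ≤ 0 + j + w ∧ 0 + (j : ℕ) ≤ i + w) := by
      intro i
      have hW : ∀ j, ¬ W i j ↔ (i : ℕ) ≤ 0 + j + w ∧ 0 + (j : ℕ) ≤ i + w := by
        intro j
        simp only [W, not_lt, abs_le]
        omega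
      simp [hW]
    simp only [hcov]
    rw [← Finset.prod_range (fun i : ℕ => if (i + 1 ≤ 0 ∨ ∃ j : Fin n, x j ≠ 0 ∧
      i ≤ 0 + j + w ∧ 0 + (j : ℕ) ≤ i + w) then (p : ℝ)⁻¹ else 1), Finset.prod_ite, prod_const,
      prod_const_one, mul_one, coveredCard, Nat.zero_add]
    congr!
  rw [e₁, e₂, e₃]
  push_cast
  rw [← prod_mul_distrib]
  exact prod_le_prod (fun _ _ => Nat.cast_nonneg _)
    fun i _ => by convert card_dotProduct_eq_zero_le (W i) x <;> rfl

open Finset in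
theorem sum_card_ker_band_le {p : ℕ} [Fact p.Prime] (n w : ℕ) :
    ∑ B : Matrix (Fin n) (Fin n) (ZMod p) with
        (∀ i j : Fin n, (w : ℤ) < |(i : ℤ) - (j : ℤ)| → B i j = 0),
      (Nat.card (LinearMap.ker B.mulVecLin) : ℝ) ≤
    (#{B : Matrix (Fin n) (Fin n) (ZMod p) |
        ∀ i j : Fin n, (w : ℤ) < |(i : ℤ) - (j : ℤ)| → B i j = 0} : ℝ) *
      coveredSum p w 0 n 0 := by
  have hker : ∀ B : Matrix (Fin n) (Fin n) (ZMod p),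
      (Nat.card (LinearMap.ker B.mulVecLin) : ℝ) =
        ∑ x : Fin n → ZMod p, if B.mulVec x = 0 then 1 else 0 := by
    intro B
    rw [sum_boole, Nat.card_eq_fintype_card, ← Fintype.card_subtype]
    simp only [Nat.cast_inj]
    exact Fintype.card_congr (Equiv.refl _)
  simp only [hker]
  rw [sum_comm, coveredSum, mul_sum]
  refine sum_le_sum fun x _ => ?_
  rw [sum_boole, filter_filter]
  exact card_band_mulVec_eq_zero_le w x

theorem coveredSum_le_of_le {p : ℕ} [Fact p.Prime] {n w : ℕ} {q : ℝ}
    (hq : 2 * (n : ℝ) * (p : ℝ) ^ (-(w : ℤ)) ≤ q) :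
    coveredSum p w 0 n 0 ≤ 1 + (q + 4) ^ 2 * Real.exp (q ^ 2) := by
  rw [zpow_neg, zpow_natCast, ← inv_pow] at hq
  have h := coveredSum_zero_bound p (w := w) 0 le_rfl (m := n)
  rw [pow_zero] at h
  set c := (p : ℝ)⁻¹ ^ w
  have hc : 0 ≤ c := pow_nonneg (inv_prime_pos p).le w
  have hq0 : 0 ≤ q := le_trans (by positivity) hq
  have hL : (1 + 2 * c) ^ n ≤ Real.exp q := by
    calc (1 + 2 * c) ^ n ≤ Real.exp (2 * c) ^ n := by
          gcongr
          linarith [Real.add_one_le_exp (2 * c)]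
      _ = Real.exp (2 * n * c) := by rw [← Real.exp_nat_mul]; congr 1; ring
      _ ≤ Real.exp q := Real.exp_le_exp.2 hq
  have hexp : Real.exp q ≤ 3 * Real.exp (q ^ 2) := by
    calc Real.exp q ≤ Real.exp (1 + q ^ 2) :=
          Real.exp_le_exp.2 (by nlinarith [sq_nonneg (q - 1 / 2)])
      _ = Real.exp 1 * Real.exp (q ^ 2) := Real.exp_add _ _
      _ ≤ 3 * Real.exp (q ^ 2) := by
          gcongr
          linarith [Real.exp_one_lt_d9]
  have hE := Real.exp_pos (q ^ 2)
  calc coveredSum p w 0 n 0 ≤ 1 + (1 + 2 * c) ^ n * (1 + n * c) := h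
    _ ≤ 1 + 3 * Real.exp (q ^ 2) * (1 + q) := by
        gcongr
        · exact hL.trans hexp
        · nlinarith [mul_nonneg (Nat.cast_nonneg (α := ℝ) n) hc]
    _ ≤ 1 + (q + 4) ^ 2 * Real.exp (q ^ 2) := by nlinarith [mul_nonneg hq0 hE.le, sq_nonneg q]

open Finset in
/-- Markov's inequality for the uniform distribution on a finite set, applied to `b ^ f`. -/
theorem card_filter_le_div_card_le {α : Type*} (S : Finset α) (f : α → ℕ) {b K : ℝ} (hb : 1 ≤ b)
    (hS : S.Nonempty) (hsum : ∑ a ∈ S, b ^ f a ≤ #S * K) (k : ℕ) :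
    (#{a ∈ S | k ≤ f a} : ℝ) / #S ≤ K * b ^ (-(k : ℤ)) := by
  have hb0 : 0 < b := one_pos.trans_le hb
  have hSpos : (0 : ℝ) < #S := mod_cast hS.card_pos
  rw [div_le_iff₀' hSpos, zpow_neg, zpow_natCast, ← mul_assoc, ← div_eq_mul_inv,
    le_div_iff₀ (pow_pos hb0 k), ← nsmul_eq_mul]
  calc #{a ∈ S | k ≤ f a} • b ^ k ≤ ∑ a ∈ S with k ≤ f a, b ^ f a :=
        card_nsmul_le_sum _ _ _ fun a ha => pow_le_pow_right₀ hb (mem_filter.1 ha).2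
    _ ≤ ∑ a ∈ S, b ^ f a :=
        sum_le_sum_of_subset_of_nonneg (filter_subset _ _) fun _ _ _ => pow_nonneg hb0.le _
    _ ≤ #S * K := hsum

theorem card_ker_mulVecLin_eq_pow {p : ℕ} [Fact p.Prime] {n : ℕ}
    (B : Matrix (Fin n) (Fin n) (ZMod p)) :
    (Nat.card (LinearMap.ker B.mulVecLin) : ℝ) =
      (p : ℝ) ^ Module.finrank (ZMod p) (LinearMap.ker B.mulVecLin) := by
  rw [Module.natCard_eq_pow_finrank (K := ZMod p), Nat.card_zmod, Nat.cast_pow]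

/-- Let `B` be a Haar-uniform `n × n` band matrix over `F_p` with band width
`w`, and suppose `2 n p^{-w} ≤ q`.  Then `E|ker B| ≤ 1 + (q+4)² exp(q²)`, and consequently
(by Markov's inequality) `P(dim ker B ≥ k) ≤ (1 + (q+4)² exp(q²)) p^{-k}` for every `k`. -/
theorem stmt19 (p : ℕ) [Fact p.Prime] (n w : ℕ) (hw : 0 < w) (hn : 0 < n)
    (q : ℝ) (hq : 2 * (n : ℝ) * (p : ℝ) ^ (-(w : ℤ)) ≤ q) :
    ((∑ B ∈ Finset.univ.filter (fun B : Matrix (Fin n) (Fin n) (ZMod p) =>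
            ∀ i j : Fin n, (w : ℤ) < |(i : ℤ) - (j : ℤ)| → B i j = 0),
          (Nat.card (LinearMap.ker B.mulVecLin) : ℝ))
        / ((Finset.univ.filter (fun B : Matrix (Fin n) (Fin n) (ZMod p) =>
            ∀ i j : Fin n, (w : ℤ) < |(i : ℤ) - (j : ℤ)| → B i j = 0)).card : ℝ)
      ≤ 1 + (q + 4) ^ 2 * Real.exp (q ^ 2)) ∧
    (∀ k : ℕ,
      ((Finset.univ.filter (fun B : Matrix (Fin n) (Fin n) (ZMod p) =>
            (∀ i j : Fin n, (w : ℤ) < |(i : ℤ) - (j : ℤ)| → B i j = 0) ∧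
            k ≤ Module.finrank (ZMod p) (LinearMap.ker B.mulVecLin))).card : ℝ)
          / ((Finset.univ.filter (fun B : Matrix (Fin n) (Fin n) (ZMod p) =>
            ∀ i j : Fin n, (w : ℤ) < |(i : ℤ) - (j : ℤ)| → B i j = 0)).card : ℝ)
        ≤ (1 + (q + 4) ^ 2 * Real.exp (q ^ 2)) * (p : ℝ) ^ (-(k : ℤ))) := by
  have hne : (Finset.univ.filter (fun B : Matrix (Fin n) (Fin n) (ZMod p) =>
      ∀ i j : Fin n, (w : ℤ) < |(i : ℤ) - (j : ℤ)| → B i j = 0)).Nonempty :=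
    ⟨0, Finset.mem_filter.2 ⟨Finset.mem_univ _, fun _ _ _ => rfl⟩⟩
  have hsum := (sum_card_ker_band_le (p := p) n w).trans
    (mul_le_mul_of_nonneg_left (coveredSum_le_of_le hq) (Nat.cast_nonneg _))
  refine ⟨(div_le_iff₀' (Nat.cast_pos.2 hne.card_pos)).2 hsum, fun k => ?_⟩
  simp only [card_ker_mulVecLin_eq_pow] at hsum
  rw [← Finset.filter_filter]
  exact card_filter_le_div_card_le _ _ (mod_cast (Fact.out : p.Prime).one_le) hne hsum k
end
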